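/- arXiv:2409.10391 — 2 statements merged into one kernel-verified Lean document; each statement's English description precedes it below -/
import Mathlib

section
/- Let x, e ∈ ℝ⁴ with ‖x‖ = 1. Then the map s ↦ F_{s·e}(x) from ℝ to ℝ⁴ is differentiable at s = 0, with derivative equal to 2(⟨e, x⟩·x − e), i.e., minus twice the orthogonal projection of e onto the orthogonal complement of x (the tangent space of S³ at x). (This is the variational formula, up to sign, stated in the paper as (d/ds)F_{s∂ᵢ}|_{s=0}.) -/
open scoped RealInnerProductSpace

/-- The conformal (Möbius) map `F_z` of the unit ball, acting on `ℝ⁴`. -/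
noncomputable def confF (z x : EuclideanSpace ℝ (Fin 4)) : EuclideanSpace ℝ (Fin 4) :=
  ((1 - ‖z‖ ^ 2) / ‖x - z‖ ^ 2) • (x - z) - z

/-- For `‖x‖ = 1` and any `e : ℝ⁴`, the map `s ↦ F_{s • e}(x)` is differentiable at `s = 0`
with derivative `2(⟪e, x⟫ • x - e)`, i.e. minus twice the orthogonal projection of `e` onto
the orthogonal complement of `x` (the tangent space of `S³` at `x`). -/
theorem hasDerivAt_confF_line (x e : EuclideanSpace ℝ (Fin 4)) (hx : ‖x‖ = 1) :
    HasDerivAt (fun s : ℝ => confF (s • e) x) ((2 : ℝ) • (⟪e, x⟫ • x - e)) 0 := by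
  have hline : HasDerivAt (fun s : ℝ => s • e) e 0 := by
    simpa using (hasDerivAt_id (0 : ℝ)).smul_const e
  have hdiff : HasDerivAt (fun s : ℝ => x - s • e) (-e) 0 := hline.const_sub x
  have hnum : HasDerivAt (fun s : ℝ => 1 - ‖s • e‖ ^ 2) 0 0 := by
    simpa using hline.norm_sq.const_sub 1
  have hden : HasDerivAt (fun s : ℝ => ‖x - s • e‖ ^ 2) (-(2 * ⟪e, x⟫)) 0 := by
    simpa [real_inner_comm] using hdiff.norm_sq
  have hquot : HasDerivAt (fun s : ℝ => (1 - ‖s • e‖ ^ 2) / ‖x - s • e‖ ^ 2) (2 * ⟪e, x⟫) 0 := by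
    simpa [hx] using hnum.fun_div hden (by simp [hx])
  refine ((hquot.fun_smul hdiff).fun_sub hline).congr_deriv ?_
  simp only [zero_smul, sub_zero, norm_zero, hx]
  module
end

section
/- Let s, s' ∈ [0,1] and let q be any point of Σ_{s'}. Then the Euclidean distance from q to the set Σ_s equals 2·sin(π|s' − s|/4), i.e., the chordal distance corresponding to the intrinsic (geodesic) distance π|s' − s|/2 in S³. In particular, the parallel torus Σ_{(1+t)/2} (the image of the Clifford torus Σ_{1/2} under the unit normal flow for signed parameter t ∈ (−1,1)) lies at geodesic distance π|t|/4 from the Clifford torus, as asserted in the paper. -/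
open Real Set Metric

/-- `ℝ²` with the Euclidean metric. -/
abbrev E2 := EuclideanSpace ℝ (Fin 2)

/-- `ℝ⁴`, identified with `ℝ² × ℝ²` (Euclidean product). -/
abbrev E4 := WithLp 2 (E2 × E2)

/-- The torus `Σ_s = {(cos(πs/2)·x, sin(πs/2)·y) : ‖x‖ = ‖y‖ = 1} ⊂ S³`;
`Σ_{1/2}` is the Clifford torus. -/
def SigmaT (s : ℝ) : Set E4 :=
  {p | ∃ x y : E2, ‖x‖ = 1 ∧ ‖y‖ = 1 ∧
    p = (WithLp.equiv 2 (E2 × E2)).symm (Real.cos (π * s / 2) • x, Real.sin (π * s / 2) • y)}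

/-- Circles of radii `a, b ≥ 0` in a normed space: points on them are at distance at least
`|a - b|`. -/
theorem sq_sub_le_sq_dist_smul {E : Type*} [NormedAddCommGroup E] [NormedSpace ℝ E] {a b : ℝ}
    (ha : 0 ≤ a) (hb : 0 ≤ b) {x y : E} (hx : ‖x‖ = 1) (hy : ‖y‖ = 1) :
    (a - b) ^ 2 ≤ dist (a • x) (b • y) ^ 2 := by
  have h := abs_norm_sub_norm_le (a • x) (b • y)
  rw [norm_smul, norm_smul, hx, hy, mul_one, mul_one, Real.norm_of_nonneg ha,
    Real.norm_of_nonneg hb, ← dist_eq_norm] at h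
  exact sq_le_sq.2 (h.trans (le_abs_self _))

theorem dist_smul_smul_of_norm_eq_one {E : Type*} [NormedAddCommGroup E] [NormedSpace ℝ E]
    (a b : ℝ) {x : E} (hx : ‖x‖ = 1) : dist (a • x) (b • x) = |a - b| := by
  rw [dist_eq_norm, ← sub_smul, norm_smul, hx, mul_one, Real.norm_eq_abs]

/-- The length of the chord between two points of the unit circle. -/
theorem cos_sub_sq_add_sin_sub_sq (α β : ℝ) :
    (Real.cos α - Real.cos β) ^ 2 + (Real.sin α - Real.sin β) ^ 2 =
      (2 * Real.sin (|α - β| / 2)) ^ 2 := by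
  have h₁ : Real.cos |α - β| = 1 - 2 * Real.sin (|α - β| / 2) ^ 2 := by
    have h := Real.cos_two_mul' (|α - β| / 2)
    rw [mul_div_cancel₀ _ two_ne_zero] at h
    linear_combination h + Real.sin_sq_add_cos_sq (|α - β| / 2)
  rw [Real.cos_abs, Real.cos_sub] at h₁
  linear_combination -2 * h₁ + Real.sin_sq_add_cos_sq α + Real.sin_sq_add_cos_sq β

/-- For `s, s' ∈ [0,1]` and any point `q ∈ Σ_{s'}`, the Euclidean distance from `q` to
the set `Σ_s` equals `2 sin(π|s' − s|/4)`, the chordal distance corresponding to the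
intrinsic (geodesic) distance `π|s' − s|/2` in `S³`. -/
theorem infDist_SigmaT (s : ℝ) (hs : s ∈ Icc (0 : ℝ) 1) (s' : ℝ) (hs' : s' ∈ Icc (0 : ℝ) 1)
    (q : E4) (hq : q ∈ SigmaT s') :
    infDist q (SigmaT s) = 2 * Real.sin (π * |s' - s| / 4) := by
  have cos_nonneg {t : ℝ} (ht : t ∈ Icc (0 : ℝ) 1) : 0 ≤ Real.cos (π * t / 2) :=
    Real.cos_nonneg_of_mem_Icc ⟨by nlinarith [pi_pos, ht.1], by nlinarith [pi_pos, ht.2]⟩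
  have sin_nonneg {t : ℝ} (ht : t ∈ Icc (0 : ℝ) 1) : 0 ≤ Real.sin (π * t / 2) :=
    Real.sin_nonneg_of_nonneg_of_le_pi (by nlinarith [pi_pos, ht.1])
      (by nlinarith [pi_pos, ht.2])
  have chord := cos_sub_sq_add_sin_sub_sq (π * s' / 2) (π * s / 2)
  have angle : |π * s' / 2 - π * s / 2| / 2 = π * |s' - s| / 4 := by
    rw [show π * s' / 2 - π * s / 2 = π / 2 * (s' - s) by ring, abs_mul,
      abs_of_pos pi_div_two_pos]
    ring
  rw [angle] at chord
  have abs_le : |s' - s| ≤ 1 := abs_le.2 ⟨by linarith [hs.2, hs'.1], by linarith [hs.1, hs'.2]⟩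
  have rhs_nonneg : 0 ≤ 2 * Real.sin (π * |s' - s| / 4) :=
    mul_nonneg zero_le_two (Real.sin_nonneg_of_nonneg_of_le_pi (by positivity)
      (by nlinarith [pi_pos]))
  obtain ⟨x, y, hx, hy, rfl⟩ := hq
  have mem : (WithLp.equiv 2 (E2 × E2)).symm
      (Real.cos (π * s / 2) • x, Real.sin (π * s / 2) • y) ∈ SigmaT s := ⟨x, y, hx, hy, rfl⟩
  apply le_antisymm
  · refine (infDist_le_dist_of_mem mem).trans ?_
    rw [WithLp.prod_dist_eq_of_L2]
    refine Real.sqrt_le_iff.2 ⟨rhs_nonneg, ?_⟩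
    simp only [WithLp.equiv_symm_apply, WithLp.toLp_fst, WithLp.toLp_snd,
      dist_smul_smul_of_norm_eq_one _ _ hx, dist_smul_smul_of_norm_eq_one _ _ hy, sq_abs]
    exact chord.le
  · refine (le_infDist ⟨_, mem⟩).2 ?_
    rintro _ ⟨u, v, hu, hv, rfl⟩
    rw [WithLp.prod_dist_eq_of_L2]
    refine Real.le_sqrt_of_sq_le (chord.symm.le.trans ?_)
    exact add_le_add (sq_sub_le_sq_dist_smul (cos_nonneg hs') (cos_nonneg hs) hx hu)
      (sq_sub_le_sq_dist_smul (sin_nonneg hs') (sin_nonneg hs) hy hv)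
end
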